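/- Let Ω ⊂ ℝ^d be a bounded measurable set with Lebesgue measure |Ω| > 0. For points ẑ_1,…,ẑ_m ∈ ℝ^d and a measurable partition {V_1,…,V_m} of Ω, define the energy K({ẑ_i},{V_i}) = Σ_{i=1}^m ∫_{V_i} ‖z − ẑ_i‖² dz. Suppose ({ẑ*_i},{V*_i}) minimizes K over all choices of m points in ℝ^d and all measurable partitions of Ω into m sets, and suppose |V*_i| > 0 for every i. Then necessarily: (i) ẑ*_i = (1/|V*_i|)∫_{V*_i} z dz is the centroid of V*_i for every i, and (ii) for every i and almost every z ∈ V*_i one has ‖z − ẑ*_i‖ ≤ ‖z − ẑ*_j‖ for all j, i.e., {V*_i} coincides almost everywhere with the Voronoi tessellation of Ω generated by {ẑ*_i}. -/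

import Mathlib

open MeasureTheory

/-- The centroid of a set `V` in Euclidean space: `ẑ = (1/|V|) ∫_V z dz`. -/
noncomputable def centroid {d : ℕ} (V : Set (EuclideanSpace ℝ (Fin d))) :
    EuclideanSpace ℝ (Fin d) :=
  ((volume V).toReal)⁻¹ • ∫ z in V, z

theorem integrableOn_norm_sub_sq {d : ℕ} {V : Set (EuclideanSpace ℝ (Fin d))}
    (hb : Bornology.IsBounded V) (a : EuclideanSpace ℝ (Fin d)) :
    IntegrableOn (fun z => ‖z - a‖ ^ 2) V := by
  have h : Continuous fun z : EuclideanSpace ℝ (Fin d) => ‖z - a‖ ^ 2 := by fun_prop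
  exact (h.continuousOn.integrableOn_compact hb.isCompact_closure).mono_set subset_closure

/-- The parallel axis theorem for a bounded set of positive volume. -/
theorem setIntegral_norm_sub_sq_eq_add {d : ℕ} {V : Set (EuclideanSpace ℝ (Fin d))}
    (hb : Bornology.IsBounded V) (hpos : 0 < volume V) (a : EuclideanSpace ℝ (Fin d)) :
    ∫ z in V, ‖z - a‖ ^ 2 =
      (∫ z in V, ‖z - centroid V‖ ^ 2) + (volume V).toReal * ‖centroid V - a‖ ^ 2 := by
  have hfin : volume V ≠ ⊤ := hb.measure_lt_top.ne
  have hvol : (volume V).toReal ≠ 0 := (ENNReal.toReal_pos hpos.ne' hfin).ne'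
  have hid : IntegrableOn (fun z : EuclideanSpace ℝ (Fin d) => z) V :=
    (continuous_id.continuousOn.integrableOn_compact hb.isCompact_closure).mono_set subset_closure
  have hconst (x : EuclideanSpace ℝ (Fin d)) : IntegrableOn (fun _ => x) V :=
    integrableOn_const hfin
  have hcenter : ∫ z in V, (z - centroid V) = 0 := by
    rw [integral_sub hid (hconst _), setIntegral_const, centroid, measureReal_def,
      smul_inv_smul₀ hvol, sub_self]
  have hdiff : IntegrableOn (fun z => z - centroid V) V := hid.sub (hconst _)
  have hinner : ∫ z in V, inner ℝ (centroid V - a) (z - centroid V) = 0 := by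
    rw [integral_inner hdiff, hcenter, inner_zero_right]
  have hexpand (z : EuclideanSpace ℝ (Fin d)) : ‖z - a‖ ^ 2 = ‖z - centroid V‖ ^ 2 +
      (2 * inner ℝ (centroid V - a) (z - centroid V) + ‖centroid V - a‖ ^ 2) := by
    rw [← sub_add_sub_cancel z (centroid V) a, norm_add_sq_real, real_inner_comm]
    ring
  have hcross : IntegrableOn
      (fun z => 2 * inner ℝ (centroid V - a) (z - centroid V)) V :=
    (hdiff.const_inner (centroid V - a)).const_mul 2
  have hnorm : IntegrableOn (fun _ => ‖centroid V - a‖ ^ 2) V :=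
    integrableOn_const hfin
  have hrest : IntegrableOn (fun z =>
      2 * inner ℝ (centroid V - a) (z - centroid V) + ‖centroid V - a‖ ^ 2) V :=
    hcross.add hnorm
  rw [integral_congr_ae (.of_forall hexpand), integral_add (integrableOn_norm_sub_sq hb _) hrest,
    integral_add hcross hnorm, integral_const_mul, hinner, setIntegral_const,
    measureReal_def, smul_eq_mul, mul_zero, zero_add]

/-- The family obtained from `V` by moving the part of `V i` lying in `B` over to `V j`. -/
def moveSubset {ι α : Type*} [DecidableEq ι] (V : ι → Set α) (i j : ι) (B : Set α) (k : ι) :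
    Set α :=
  if k = i then V i \ B else if k = j then V j ∪ V i ∩ B else V k

theorem pairwise_disjoint_moveSubset {ι α : Type*} [DecidableEq ι] {V : ι → Set α}
    (hV : Pairwise (Function.onFun Disjoint V)) {i j : ι} (B : Set α) :
    Pairwise (Function.onFun Disjoint (moveSubset V i j B)) := by
  intro k l hkl
  have h (p q : ι) (x : α) (hp : x ∈ V p) (hq : x ∈ V q) : p = q := by
    by_contra hpq
    exact Set.disjoint_left.1 (hV hpq) hp hq
  refine Set.disjoint_left.2 fun x hk hl => ?_
  unfold moveSubset at hk hl
  split_ifs at hk hl <;> grind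

theorem iUnion_moveSubset {ι α : Type*} [DecidableEq ι] (V : ι → Set α) {i j : ι}
    (hij : i ≠ j) (B : Set α) : ⋃ k, moveSubset V i j B k = ⋃ k, V k := by
  ext x
  simp only [Set.mem_iUnion]
  constructor
  · rintro ⟨k, hk⟩
    unfold moveSubset at hk
    split_ifs at hk <;> grind
  · rintro ⟨k, hk⟩
    by_cases hx : x ∈ V i ∧ x ∈ B
    · exact ⟨j, by simp [moveSubset, hij.symm, hx]⟩
    · refine ⟨k, ?_⟩
      unfold moveSubset
      split_ifs <;> grind

theorem measurableSet_moveSubset {ι α : Type*} [DecidableEq ι] [MeasurableSpace α]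
    {V : ι → Set α} (hV : ∀ k, MeasurableSet (V k)) (i j : ι) {B : Set α}
    (hB : MeasurableSet B) (k : ι) : MeasurableSet (moveSubset V i j B k) := by
  unfold moveSubset
  split_ifs
  exacts [(hV i).diff hB, (hV j).union ((hV i).inter hB), hV k]

/-- Moving `V i ∩ B` from `V i` to `V j` changes a sum of integrals by the difference of the
integrands over the moved set. -/
theorem sum_setIntegral_moveSubset {ι α : Type*} [Fintype ι] [DecidableEq ι]
    [MeasurableSpace α] {μ : Measure α} {V : ι → Set α}
    (hV : ∀ k, MeasurableSet (V k)) (hdisj : Pairwise (Function.onFun Disjoint V))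
    {i j : ι} (hij : i ≠ j) {B : Set α} (hB : MeasurableSet B) {f : ι → α → ℝ}
    (hf : ∀ k l, IntegrableOn (f k) (V l) μ) :
    ∑ k, ∫ z in moveSubset V i j B k, f k z ∂μ =
      (∑ k, ∫ z in V k, f k z ∂μ) + ∫ z in V i ∩ B, (f j z - f i z) ∂μ := by
  have hsum : ∑ k, ((∫ z in moveSubset V i j B k, f k z ∂μ) - ∫ z in V k, f k z ∂μ) =
      ((∫ z in V i \ B, f i z ∂μ) - ∫ z in V i, f i z ∂μ) +
      ((∫ z in V j ∪ V i ∩ B, f j z ∂μ) - ∫ z in V j, f j z ∂μ) := by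
    rw [Fintype.sum_eq_add i j hij fun k hk => by simp [moveSubset, hk.1, hk.2]]
    simp [moveSubset, hij.symm]
  have hmoved (k : ι) : IntegrableOn (f k) (V i ∩ B) μ :=
    (hf k i).mono_set Set.inter_subset_left
  have hunion := setIntegral_union ((hdisj hij.symm).mono_right Set.inter_subset_left)
    ((hV i).inter hB) (hf j j) (hmoved j)
  have hsplit := integral_inter_add_sdiff hB (hf i i)
  rw [Finset.sum_sub_distrib] at hsum
  rw [integral_sub (hmoved j) (hmoved i)]
  linarith

/-- Let `Ω ⊂ ℝ^d` be bounded measurable with `|Ω| > 0`. Suppose the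
points `ẑ*_1,…,ẑ*_m` together with the measurable partition `{V*_i}` of `Ω` (with
`|V*_i| > 0` for all `i`) minimize the energy
`K({ẑ_i},{V_i}) = Σ_i ∫_{V_i} ‖z − ẑ_i‖² dz` over all `m` points of `ℝ^d` and all
measurable partitions of `Ω` into `m` sets. Then necessarily (i) each `ẑ*_i` is the
centroid of `V*_i`, and (ii) for each `i` and almost every `z ∈ V*_i`,
`‖z − ẑ*_i‖ ≤ ‖z − ẑ*_j‖` for all `j`: the partition coincides almost everywhere
with the Voronoi tessellation generated by the `ẑ*_i`, i.e. it is a CVT. -/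
theorem minimizer_of_energy_is_CVT {d m : ℕ}
    (Ω : Set (EuclideanSpace ℝ (Fin d)))
    (hΩmeas : MeasurableSet Ω) (hΩb : Bornology.IsBounded Ω) (hΩpos : 0 < volume Ω)
    (zstar : Fin m → EuclideanSpace ℝ (Fin d))
    (V : Fin m → Set (EuclideanSpace ℝ (Fin d)))
    (hVmeas : ∀ i, MeasurableSet (V i))
    (hVdisj : Pairwise (Function.onFun Disjoint V))
    (hVunion : ⋃ i, V i = Ω)
    (hVpos : ∀ i, 0 < volume (V i))
    (hmin : ∀ (c : Fin m → EuclideanSpace ℝ (Fin d))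
      (W : Fin m → Set (EuclideanSpace ℝ (Fin d))),
      (∀ i, MeasurableSet (W i)) → Pairwise (Function.onFun Disjoint W) →
      (⋃ i, W i = Ω) →
      ∑ i, ∫ z in V i, ‖z - zstar i‖ ^ 2 ≤ ∑ i, ∫ z in W i, ‖z - c i‖ ^ 2) :
    (∀ i, zstar i = centroid (V i)) ∧
    (∀ i, ∀ᵐ z ∂(volume.restrict (V i)), ∀ j, ‖z - zstar i‖ ≤ ‖z - zstar j‖) := by
  classical
  have hb (i) : Bornology.IsBounded (V i) :=
    hΩb.subset (hVunion ▸ Set.subset_iUnion V i)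
  refine ⟨fun i => ?_, fun i => ae_all_iff.2 fun j => ?_⟩
  · have hle := hmin (Function.update zstar i (centroid (V i))) V hVmeas hVdisj hVunion
    have hrest : ∑ k ∈ Finset.univ.erase i, ∫ z in V k,
          ‖z - Function.update zstar i (centroid (V i)) k‖ ^ 2 =
        ∑ k ∈ Finset.univ.erase i, ∫ z in V k, ‖z - zstar k‖ ^ 2 :=
      Finset.sum_congr rfl fun k hk => by
        rw [Function.update_of_ne (Finset.ne_of_mem_erase hk)]
    rw [← Finset.add_sum_erase _ _ (Finset.mem_univ i),
      ← Finset.add_sum_erase _ _ (Finset.mem_univ i), hrest, Function.update_self,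
      add_le_add_iff_right, setIntegral_norm_sub_sq_eq_add (hb i) (hVpos i) (zstar i)] at hle
    have hvol := ENNReal.toReal_pos (hVpos i).ne' (hb i).measure_lt_top.ne
    have hzero : ‖centroid (V i) - zstar i‖ ^ 2 = 0 := by
      nlinarith [sq_nonneg ‖centroid (V i) - zstar i‖]
    exact (sub_eq_zero.1 (norm_eq_zero.1 (pow_eq_zero_iff two_ne_zero |>.1 hzero))).symm
  · obtain rfl | hij := eq_or_ne i j
    · exact .of_forall fun _ => le_rfl
    set B : Set (EuclideanSpace ℝ (Fin d)) := {z | ‖z - zstar j‖ < ‖z - zstar i‖} with hBdef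
    have hB : MeasurableSet B := measurableSet_lt (by fun_prop) (by fun_prop)
    have hle := hmin zstar (moveSubset V i j B) (measurableSet_moveSubset hVmeas i j hB)
      (pairwise_disjoint_moveSubset hVdisj B) ((iUnion_moveSubset V hij B).trans hVunion)
    have hint (k l) := integrableOn_norm_sub_sq (hb l) (zstar k)
    rw [sum_setIntegral_moveSubset hVmeas hVdisj hij hB hint, le_add_iff_nonneg_right] at hle
    have hneg : ∀ z ∈ V i ∩ B, ‖z - zstar j‖ ^ 2 - ‖z - zstar i‖ ^ 2 < 0 := fun z hz =>
      sub_neg.2 (pow_lt_pow_left₀ hz.2 (norm_nonneg _) two_ne_zero)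
    have hnull : volume (V i ∩ B) = 0 := by
      by_contra hne
      have hpos : 0 < ∫ z in V i ∩ B, (‖z - zstar i‖ ^ 2 - ‖z - zstar j‖ ^ 2) := by
        refine (setIntegral_pos_iff_support_of_nonneg_ae ?_ ?_).2 ?_
        · filter_upwards [ae_restrict_mem ((hVmeas i).inter hB)] with z hz
          simpa using (sub_neg.1 (hneg z hz)).le
        · exact ((hint i i).sub (hint j i)).mono_set Set.inter_subset_left
        · refine (pos_iff_ne_zero.2 hne).trans_le (measure_mono fun z hz => ⟨?_, hz⟩)
          exact (sub_pos.2 (sub_neg.1 (hneg z hz))).ne'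
      have hflip := integral_neg (μ := volume.restrict (V i ∩ B))
        fun z => ‖z - zstar i‖ ^ 2 - ‖z - zstar j‖ ^ 2
      simp only [neg_sub] at hflip
      linarith
    rw [ae_restrict_iff' (hVmeas i), ae_iff]
    convert hnull using 2
    ext z
    simp [hBdef]
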